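/- Under the stated setup, if (q̄, b̄) is feasible for problem P5, then the iterates of the iteration ω^{[0]} = 0, ω^{[n+1]} = T(ω^{[n]}) satisfy ω^{[n]}_{i,k} ≤ q̄_{i,k} for every n ≥ 0 and every i ∈ {1,2}, k ∈ K. -/

import Mathlib

open Matrix Finset

/-- Interference-plus-noise covariance matrix `Jₖ(ω) = Σⱼ Σ_{l≠k} ω_{j,l} h_{j,l} h_{j,l}ᴴ + σ²I`. -/
noncomputable def Jmat {N : ℕ} {K : Type*} [Fintype K] [DecidableEq K]
    (h : Fin 2 → K → (Fin N → ℂ)) (σ2 : ℝ) (ω : Fin 2 → K → ℝ) (k : K) :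
    Matrix (Fin N) (Fin N) ℂ :=
  (∑ j : Fin 2, ∑ l ∈ Finset.univ.filter (fun l => l ≠ k),
      ((ω j l : ℝ) : ℂ) • Matrix.vecMulVec (h j l) (star (h j l))) + (σ2 : ℂ) • 1

/-- Fixed-point map `T(ω)_{i,k} = α_{i,k} / Re( h_{i,k}ᴴ Jₖ(ω)⁻¹ h_{i,k} )`. -/
noncomputable def Tmap {N : ℕ} {K : Type*} [Fintype K] [DecidableEq K]
    (h : Fin 2 → K → (Fin N → ℂ)) (σ2 : ℝ) (α : Fin 2 → K → ℝ)
    (ω : Fin 2 → K → ℝ) (i : Fin 2) (k : K) : ℝ :=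
  α i k / (star (h i k) ⬝ᵥ ((Jmat h σ2 ω k)⁻¹ *ᵥ h i k)).re

/-- Feasibility of a pair `(q, b)` for problem P5. -/
def FeasibleP5 {N : ℕ} {K : Type*} [Fintype K] [DecidableEq K]
    (h : Fin 2 → K → (Fin N → ℂ)) (σ2 : ℝ) (α : Fin 2 → K → ℝ)
    (q : Fin 2 → K → ℝ) (b : Fin 2 → K → (Fin N → ℂ)) : Prop :=
  (∀ i k, 0 ≤ q i k) ∧ (∀ i k, b i k ≠ 0) ∧
  ∀ (i : Fin 2) (k : K),
    α i k * ((∑ j : Fin 2, ∑ l ∈ Finset.univ.filter (fun l => l ≠ k),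
        q j l * ‖star (b i k) ⬝ᵥ h j l‖ ^ 2) + σ2 * (star (b i k) ⬝ᵥ b i k).re)
      ≤ q i k * ‖star (b i k) ⬝ᵥ h i k‖ ^ 2

open scoped ComplexOrder

/-- Cauchy-Schwarz for the sesquilinear form of a positive semidefinite matrix. -/
theorem Matrix.PosSemidef.normSq_dotProduct_mulVec_le {𝕜 n : Type*} [RCLike 𝕜] [Fintype n]
    {M : Matrix n n 𝕜} (hM : M.PosSemidef) (x y : n → 𝕜) :
    ‖star x ⬝ᵥ (M *ᵥ y)‖ ^ 2 ≤
      RCLike.re (star x ⬝ᵥ (M *ᵥ x)) * RCLike.re (star y ⬝ᵥ (M *ᵥ y)) := by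
  let _ : SeminormedAddCommGroup (n → 𝕜) := M.toSeminormedAddCommGroup hM
  let _ : InnerProductSpace 𝕜 (n → 𝕜) := M.toInnerProductSpace hM
  have hinner (u v : n → 𝕜) : inner 𝕜 u v = star u ⬝ᵥ (M *ᵥ v) := dotProduct_comm _ _
  have hcs := inner_mul_inner_self_le (𝕜 := 𝕜) x y
  rwa [norm_inner_symm y x, ← sq, hinner, hinner, hinner] at hcs

/-- If `A` is positive definite then `|bᴴ v|² ≤ (bᴴ A b) (vᴴ A⁻¹ v)`. -/
theorem Matrix.PosDef.normSq_dotProduct_le {𝕜 n : Type*} [RCLike 𝕜] [Fintype n] [DecidableEq n]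
    {A : Matrix n n 𝕜} (hA : A.PosDef) (b v : n → 𝕜) :
    ‖star b ⬝ᵥ v‖ ^ 2 ≤
      RCLike.re (star b ⬝ᵥ (A *ᵥ b)) * RCLike.re (star v ⬝ᵥ (A⁻¹ *ᵥ v)) := by
  have hv : A *ᵥ (A⁻¹ *ᵥ v) = v := by
    rw [mulVec_mulVec, mul_nonsing_inv _ ((isUnit_iff_isUnit_det A).mp hA.isUnit), one_mulVec]
  have hcs := hA.posSemidef.normSq_dotProduct_mulVec_le b (A⁻¹ *ᵥ v)
  rwa [hv, star_mulVec, hA.inv.isHermitian.eq, ← dotProduct_mulVec] at hcs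

section

variable {N : ℕ} {K : Type*} [Fintype K] [DecidableEq K]
  {h : Fin 2 → K → (Fin N → ℂ)} {σ2 : ℝ} {ω : Fin 2 → K → ℝ}

theorem posDef_Jmat (hσ : 0 < σ2) (hω : 0 ≤ ω) (k : K) : (Jmat h σ2 ω k).PosDef := by
  refine PosDef.posSemidef_add ?_ (PosDef.one.smul (by exact_mod_cast hσ))
  refine posSemidef_sum _ fun j _ ↦ posSemidef_sum _ fun l _ ↦ ?_
  exact (posSemidef_vecMulVec_self_star _).smul (by exact_mod_cast hω j l)

theorem re_dotProduct_Jmat_mulVec (k : K) (b : Fin N → ℂ) :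
    (star b ⬝ᵥ (Jmat h σ2 ω k *ᵥ b)).re =
      (∑ j : Fin 2, ∑ l ∈ Finset.univ.filter (fun l => l ≠ k),
        ω j l * ‖star b ⬝ᵥ h j l‖ ^ 2) + σ2 * (star b ⬝ᵥ b).re := by
  have hrank (v : Fin N → ℂ) :
      star b ⬝ᵥ (vecMulVec v (star v) *ᵥ b) = ((‖star b ⬝ᵥ v‖ ^ 2 : ℝ) : ℂ) := by
    have hv : star v ⬝ᵥ b = star (star b ⬝ᵥ v) := star_dotProduct _ _
    rw [vecMulVec_mulVec, hv, op_smul_eq_smul, dotProduct_smul, smul_eq_mul, mul_comm]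
    push_cast
    exact RCLike.mul_conj _
  simp only [Jmat, add_mulVec, sum_mulVec, smul_mulVec, one_mulVec, dotProduct_add, dotProduct_sum,
    dotProduct_smul, hrank, smul_eq_mul, Complex.add_re, Complex.re_sum, Complex.re_ofReal_mul,
    Complex.ofReal_re]

theorem Tmap_nonneg {α : Fin 2 → K → ℝ} (hα : ∀ i k, 0 ≤ α i k) (hσ : 0 < σ2) (hω : 0 ≤ ω) :
    0 ≤ Tmap h σ2 α ω :=
  fun i k ↦ div_nonneg (hα i k) ((posDef_Jmat hσ hω k).inv.posSemidef.re_dotProduct_nonneg _)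

/-- The map `T` sends the order interval `[0, q]` below `q` when `q` is feasible. -/
theorem Tmap_le_of_feasible {α q : Fin 2 → K → ℝ} {b : Fin 2 → K → (Fin N → ℂ)}
    (hh : ∀ i k, h i k ≠ 0) (hα : ∀ i k, 0 ≤ α i k) (hσ : 0 < σ2)
    (hfeas : FeasibleP5 h σ2 α q b) (hω : 0 ≤ ω) (hωq : ω ≤ q) : Tmap h σ2 α ω ≤ q := by
  intro i k
  obtain ⟨hq, hb, hsinr⟩ := hfeas
  have hJ := posDef_Jmat (h := h) hσ hω k
  have hpos : 0 < (star (b i k) ⬝ᵥ (Jmat h σ2 ω k *ᵥ b i k)).re := hJ.re_dotProduct_pos (hb i k)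
  have hgain : 0 < (star (h i k) ⬝ᵥ ((Jmat h σ2 ω k)⁻¹ *ᵥ h i k)).re :=
    hJ.inv.re_dotProduct_pos (hh i k)
  have hmono : (star (b i k) ⬝ᵥ (Jmat h σ2 ω k *ᵥ b i k)).re ≤
      (∑ j : Fin 2, ∑ l ∈ Finset.univ.filter (fun l => l ≠ k),
        q j l * ‖star (b i k) ⬝ᵥ h j l‖ ^ 2) + σ2 * (star (b i k) ⬝ᵥ b i k).re := by
    rw [re_dotProduct_Jmat_mulVec]
    gcongr with j _ l _
    exact hωq j l
  refine (div_le_iff₀ hgain).mpr (le_of_mul_le_mul_right ?_ hpos)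
  calc α i k * (star (b i k) ⬝ᵥ (Jmat h σ2 ω k *ᵥ b i k)).re
      ≤ q i k * ‖star (b i k) ⬝ᵥ h i k‖ ^ 2 :=
        (mul_le_mul_of_nonneg_left hmono (hα i k)).trans (hsinr i k)
    _ ≤ q i k * ((star (b i k) ⬝ᵥ (Jmat h σ2 ω k *ᵥ b i k)).re *
          (star (h i k) ⬝ᵥ ((Jmat h σ2 ω k)⁻¹ *ᵥ h i k)).re) :=
        mul_le_mul_of_nonneg_left (hJ.normSq_dotProduct_le _ _) (hq i k)
    _ = _ := by ring

end

/-- The iterates of `ω⁰ = 0`, `ωⁿ⁺¹ = T(ωⁿ)` are bounded above by any feasible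
power vector of P5 (proof of Proposition 3). -/
theorem stmt_12 {N : ℕ} {K : Type*} [Fintype K] [DecidableEq K]
    (h : Fin 2 → K → (Fin N → ℂ)) (σ2 : ℝ) (α : Fin 2 → K → ℝ)
    (hh : ∀ i k, h i k ≠ 0) (hα : ∀ i k, 0 < α i k) (hσ : 0 < σ2)
    (q : Fin 2 → K → ℝ) (b : Fin 2 → K → (Fin N → ℂ))
    (hfeas : FeasibleP5 h σ2 α q b) :
    ∀ (n : ℕ) (i : Fin 2) (k : K), (Tmap h σ2 α)^[n] 0 i k ≤ q i k := by
  have hmem : ∀ n : ℕ, 0 ≤ (Tmap h σ2 α)^[n] 0 ∧ (Tmap h σ2 α)^[n] 0 ≤ q := by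
    intro n
    induction n with
    | zero => exact ⟨le_rfl, hfeas.1⟩
    | succ n ih =>
      rw [Function.iterate_succ_apply']
      exact ⟨Tmap_nonneg (fun i k ↦ (hα i k).le) hσ ih.1,
        Tmap_le_of_feasible hh (fun i k ↦ (hα i k).le) hσ hfeas ih.1 ih.2⟩
  exact fun n ↦ (hmem n).2
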